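/- arXiv:2312.14982 — 10 statements merged into one kernel-verified Lean document; each statement's English description precedes it below -/
import Mathlib

section
/- For every q ∈ ℝ₊^J one has h·q − ĥ(KMq) = |λ|·d̃(q). -/
open Matrix

/-- `(KM)q` where `M` is the diagonal matrix with entries `1/βⱼ`. -/
noncomputable def kmVec {I J : ℕ} (K : Matrix (Fin I) (Fin J) ℝ) (β : Fin J → ℝ)
    (q : Fin J → ℝ) : Fin I → ℝ :=
  K.mulVec fun j => q j / β j

/-- `ĥ(w) = inf { h·q : q ∈ ℝ₊^J, KMq = w }`. -/
noncomputable def hhat {I J : ℕ} (K : Matrix (Fin I) (Fin J) ℝ) (β h : Fin J → ℝ)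
    (w : Fin I → ℝ) : ℝ :=
  sInf {x : ℝ | ∃ q : Fin J → ℝ, (∀ j, 0 ≤ q j) ∧ kmVec K β q = w ∧ x = h ⬝ᵥ q}

/-- `d̃(q) = sup { v·u* : v ∈ ker K, q + βv ≥ 0 }`. -/
noncomputable def dtilde {I J : ℕ} (K : Matrix (Fin I) (Fin J) ℝ) (β ustar : Fin J → ℝ)
    (q : Fin J → ℝ) : ℝ :=
  sSup {x : ℝ | ∃ v : Fin J → ℝ, K.mulVec v = 0 ∧ (∀ j, 0 ≤ q j + β j * v j) ∧ x = v ⬝ᵥ ustar}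

/-- On `ker K`, a linear functional `w` is determined by the component along a unit vector
`u` of `ker K` orthogonal to the kernel of `w` in `ker K`. -/
theorem dotProduct_eq_mul_of_orthogonal {I J : ℕ} {K : Matrix (Fin I) (Fin J) ℝ}
    {w u : Fin J → ℝ} (hker : K.mulVec u = 0) (hunit : u ⬝ᵥ u = 1)
    (horth : ∀ v : Fin J → ℝ, K.mulVec v = 0 → w ⬝ᵥ v = 0 → v ⬝ᵥ u = 0)
    (hne : w ⬝ᵥ u ≠ 0) {v : Fin J → ℝ} (hv : K.mulVec v = 0) :
    w ⬝ᵥ v = (w ⬝ᵥ u) * (v ⬝ᵥ u) := by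
  have key := horth (v - ((w ⬝ᵥ v) / (w ⬝ᵥ u)) • u)
    (by rw [mulVec_sub, mulVec_smul, hv, hker, smul_zero, sub_zero])
    (by rw [dotProduct_sub, dotProduct_smul, smul_eq_mul, div_mul_cancel₀ _ hne, sub_self])
  rw [sub_dotProduct, smul_dotProduct, hunit, smul_eq_mul, mul_one, sub_eq_zero] at key
  rw [key, mul_div_cancel₀ _ hne]

theorem kmVec_add_mul {I J : ℕ} (K : Matrix (Fin I) (Fin J) ℝ) {β : Fin J → ℝ}
    (hβ : ∀ j, 0 < β j) (q v : Fin J → ℝ) :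
    kmVec K β (fun j => q j + β j * v j) = kmVec K β q + K.mulVec v := by
  rw [kmVec, kmVec, ← mulVec_add]
  congr 1
  funext j
  have := (hβ j).ne'
  simp only [Pi.add_apply]
  field_simp

theorem dotProduct_add_mul {J : ℕ} (h β q v : Fin J → ℝ) :
    h ⬝ᵥ (fun j => q j + β j * v j) = h ⬝ᵥ q + (fun j => h j * β j) ⬝ᵥ v := by
  simp only [dotProduct, ← Finset.sum_add_distrib]
  exact Finset.sum_congr rfl fun j _ => by ring


theorem stmt0 (I J : ℕ) (hI : 0 < I) (hJ : 0 < J)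
    (K : Matrix (Fin I) (Fin J) ℝ)
    (hK01 : ∀ i j, K i j = 0 ∨ K i j = 1)
    (hcol : ∀ j, ∃ i, K i j = 1)
    (hloc : ∀ i, ∃ j, K i j = 1 ∧ ∀ l, l ≠ i → K l j = 0)
    (β : Fin J → ℝ) (hβ : ∀ j, 0 < β j)
    (h : Fin J → ℝ) (hh : ∀ j, 0 < h j)
    (hC : {u : Fin J → ℝ | K.mulVec u = 0 ∧ (fun j => h j * β j) ⬝ᵥ u = 0} ≠
          {u : Fin J → ℝ | K.mulVec u = 0})
    (ustar : Fin J → ℝ)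
    (hker : K.mulVec ustar = 0)
    (hunit : ∑ j, ustar j ^ 2 = 1)
    (horth : ∀ u : Fin J → ℝ, K.mulVec u = 0 → (fun j => h j * β j) ⬝ᵥ u = 0 →
      u ⬝ᵥ ustar = 0)
    (hneg : (fun j => h j * β j) ⬝ᵥ ustar < 0)
    (q : Fin J → ℝ) (hq : ∀ j, 0 ≤ q j) :
    h ⬝ᵥ q - hhat K β h (kmVec K β q) =
      |(fun j => h j * β j) ⬝ᵥ ustar| * dtilde K β ustar q := by
  have hval : ∀ v : Fin J → ℝ, K.mulVec v = 0 →
      (fun j => h j * β j) ⬝ᵥ v = ((fun j => h j * β j) ⬝ᵥ ustar) * (v ⬝ᵥ ustar) :=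
    fun v hv => dotProduct_eq_mul_of_orthogonal hker
      (by simpa only [dotProduct, sq] using hunit) horth hneg.ne hv
  rw [abs_of_neg hneg]
  set c := (fun j => h j * β j) ⬝ᵥ ustar
  have hbdd : BddBelow {x : ℝ | ∃ p : Fin J → ℝ,
      (∀ j, 0 ≤ p j) ∧ kmVec K β p = kmVec K β q ∧ x = h ⬝ᵥ p} := by
    refine ⟨0, ?_⟩
    rintro x ⟨p, hp, -, rfl⟩
    exact Finset.sum_nonneg fun j _ => mul_nonneg (hh j).le (hp j)
  have hlub : IsLUB {x : ℝ | ∃ v : Fin J → ℝ,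
      K.mulVec v = 0 ∧ (∀ j, 0 ≤ q j + β j * v j) ∧ x = v ⬝ᵥ ustar}
      ((h ⬝ᵥ q - hhat K β h (kmVec K β q)) / -c) := by
    constructor
    · rintro x ⟨v, hv, hpos, rfl⟩
      rw [le_div_iff₀ (neg_pos.2 hneg)]
      have hle : hhat K β h (kmVec K β q) ≤ h ⬝ᵥ (fun j => q j + β j * v j) :=
        csInf_le hbdd ⟨_, hpos, by rw [kmVec_add_mul K hβ, hv, add_zero], rfl⟩
      rw [dotProduct_add_mul, hval v hv] at hle
      linarith
    · intro b hb
      rw [div_le_iff₀ (neg_pos.2 hneg), sub_le_comm]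
      refine le_csInf ⟨_, q, hq, rfl, rfl⟩ ?_
      rintro x ⟨p, hp, hpq, rfl⟩
      have hpv : (fun j => q j + β j * ((p j - q j) / β j)) = p := by
        funext j
        rw [mul_div_cancel₀ _ (hβ j).ne', add_sub_cancel]
      have hv : K.mulVec (fun j => (p j - q j) / β j) = 0 := by
        have hkm := kmVec_add_mul K hβ q (fun j => (p j - q j) / β j)
        rwa [hpv, hpq, left_eq_add] at hkm
      have hle := hb ⟨_, hv, fun j => (congrFun hpv j).symm ▸ hp j, rfl⟩
      have hdot := dotProduct_add_mul h β q (fun j => (p j - q j) / β j)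
      rw [hpv, hval _ hv] at hdot
      rw [hdot]
      linarith [mul_le_mul_of_nonneg_right hle (neg_pos.2 hneg).le]
  rw [dtilde, hlub.csSup_eq ⟨_, 0, mulVec_zero K, by simpa using hq, rfl⟩,
    mul_div_cancel₀ _ (neg_pos.2 hneg).ne']
end

section
/- Let q ∈ ℝ₊^J and define z^q ∈ {0,1}^J by z^q_j = 1 if q_j = 0 and z^q_j = 0 otherwise. Let 𝓜 = {z ∈ {0,1}^J : there exists v ∈ ker(K) with v_j ≥ 0 for every j such that z_j = 1, and v·u* > 0}. If z^q ∉ 𝓜, then d̃(q) = 0. -/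
open Matrix

/-- If `z^q ∉ 𝓜`, i.e. there is no `v ∈ ker K` with `vⱼ ≥ 0` whenever `qⱼ = 0` and
`v·u* > 0`, then `d̃(q) = 0`. -/
theorem stmt1 (I J : ℕ) (hI : 0 < I) (hJ : 0 < J)
    (K : Matrix (Fin I) (Fin J) ℝ)
    (hK01 : ∀ i j, K i j = 0 ∨ K i j = 1)
    (hcol : ∀ j, ∃ i, K i j = 1)
    (hloc : ∀ i, ∃ j, K i j = 1 ∧ ∀ l, l ≠ i → K l j = 0)
    (β : Fin J → ℝ) (hβ : ∀ j, 0 < β j)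
    (h : Fin J → ℝ) (hh : ∀ j, 0 < h j)
    (hC : {u : Fin J → ℝ | K.mulVec u = 0 ∧ (fun j => h j * β j) ⬝ᵥ u = 0} ≠
          {u : Fin J → ℝ | K.mulVec u = 0})
    (ustar : Fin J → ℝ)
    (hker : K.mulVec ustar = 0)
    (hunit : ∑ j, ustar j ^ 2 = 1)
    (horth : ∀ u : Fin J → ℝ, K.mulVec u = 0 → (fun j => h j * β j) ⬝ᵥ u = 0 →
      u ⬝ᵥ ustar = 0)
    (hneg : (fun j => h j * β j) ⬝ᵥ ustar < 0)
    (q : Fin J → ℝ) (hq : ∀ j, 0 ≤ q j)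
    (hznotM : ¬ ∃ v : Fin J → ℝ, K.mulVec v = 0 ∧ (∀ j, q j = 0 → 0 ≤ v j) ∧
      0 < v ⬝ᵥ ustar) :
    dtilde K β ustar q = 0 := by
  refine IsGreatest.csSup_eq ⟨⟨0, by simp, fun j => by simpa using hq j, by simp⟩, ?_⟩
  rintro x ⟨v, hv, hfeas, rfl⟩
  by_contra! hpos
  refine hznotM ⟨v, hv, fun j hj => ?_, hpos⟩
  have hj' := hfeas j
  rw [hj, zero_add] at hj'
  exact nonneg_of_mul_nonneg_right hj' (hβ j)
end

section
/- For every z ∈ {0,1}^J there exists a vector v ∈ ℝ^J such that (Kv)_i = 0 for every i ∈ A_z and v_j > 0 for every j ∈ {1,…,J} with z_j = 1. -/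
open Matrix

/-- For every `z ∈ {0,1}^J` there is `v ∈ ℝ^J` with `(Kv)ᵢ = 0` for all
`i ∈ A_z = {i : ∃ j, K i j = 1 ∧ z j = 0}` and `vⱼ > 0` for every `j` with `zⱼ = 1`. -/
theorem stmt2 (I J : ℕ) (hI : 0 < I) (hJ : 0 < J)
    (K : Matrix (Fin I) (Fin J) ℝ)
    (hK01 : ∀ i j, K i j = 0 ∨ K i j = 1)
    (hloc : ∀ i, ∃ j, K i j = 1 ∧ ∀ l, l ≠ i → K l j = 0)
    (z : Fin J → Bool) :
    ∃ v : Fin J → ℝ,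
      (∀ i : Fin I, (∃ j : Fin J, K i j = 1 ∧ z j = false) → K.mulVec v i = 0) ∧
      ∀ j : Fin J, z j = true → 0 < v j := by
  choose c hc1 hc0 using hloc
  have hKc : ∀ i l, K i (c l) = if l = i then 1 else 0 := by
    intro i l
    split_ifs with h
    · exact h ▸ hc1 l
    · exact hc0 l i (Ne.symm h)
  classical
  let u : Fin J → ℝ := fun j => if z j = true then 1 else -(J : ℝ)
  let w : Fin I → ℝ := fun i =>
    if ∃ j : Fin J, K i j = 1 ∧ z j = false then K.mulVec u i else 0
  have hw : ∀ i, w i ≤ 0 := by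
    intro i
    by_cases hi : ∃ j : Fin J, K i j = 1 ∧ z j = false
    · simp only [w, ite_true, hi, Matrix.mulVec, dotProduct]
      obtain ⟨k, hk, hz⟩ := hi
      calc ∑ j, K i j * u j ≤ ∑ j, (1 - if j = k then (J : ℝ) else 0) := by
            refine Finset.sum_le_sum fun j _ => ?_
            have hJ' : (0 : ℝ) ≤ J := Nat.cast_nonneg J
            by_cases h : j = k
            · subst h
              simp [u, hk, hz]
            · rcases hK01 i j with h' | h' <;> by_cases hzj : z j = true <;>
                simp [u, h, h', hzj] <;> linarith
        _ = 0 := by simp [Finset.sum_sub_distrib]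
    · simp [w, hi]
  refine ⟨fun j => u j - ∑ i, if c i = j then w i else 0, fun i hi => ?_, fun j hj => ?_⟩
  · have h1 : ∑ j, K i j * (∑ l, if c l = j then w l else 0) = w i := by
      simp_rw [Finset.mul_sum]
      rw [Finset.sum_comm]
      simp [hKc]
    have h2 : w i = K.mulVec u i := if_pos hi
    simp only [Matrix.mulVec, dotProduct, mul_sub, Finset.sum_sub_distrib] at h2 ⊢
    rw [h1, h2, sub_self]
  · have h1 : ∑ i, (if c i = j then w i else 0) ≤ 0 :=
      Finset.sum_nonpos fun i _ => by split_ifs <;> simp [hw]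
    have h2 : u j = 1 := if_pos hj
    linarith
end

section
/- Let f : [0,T] → ℝ be cadlag. Let h₃ : [0,T] → ℝ be cadlag and nondecreasing with h₃(0) ≥ 0, and suppose φ₃ := f + h₃ satisfies φ₃(t) ≥ 0 for all t ∈ [0,T]. Then Γ₁(f)(t) ≤ φ₃(t) for all t ∈ [0,T]. -/
open Set Filter

/-- `f` is cadlag on `[0,T]`: right-continuous on `[0,T)` with left limits on `(0,T]`. -/
def CadlagOn (f : ℝ → ℝ) (T : ℝ) : Prop :=
  (∀ t ∈ Set.Ico (0:ℝ) T, Filter.Tendsto f (nhdsWithin t (Set.Ici t)) (nhds (f t))) ∧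
  (∀ t ∈ Set.Ioc (0:ℝ) T, ∃ L : ℝ, Filter.Tendsto f (nhdsWithin t (Set.Iio t)) (nhds L))

/-- The one-dimensional Skorohod map: `Γ₁(f)(t) = f(t) + sup_{s ∈ [0,t]} max(−f(s), 0)`. -/
noncomputable def skorohod1 (f : ℝ → ℝ) (t : ℝ) : ℝ :=
  f t + sSup ((fun s => max (-f s) 0) '' Set.Icc 0 t)

/-- If `h₃` is nondecreasing and cadlag on `[0,T]` with `h₃(0) ≥ 0` and
`φ₃ = f + h₃ ≥ 0` on `[0,T]`, then `Γ₁(f) ≤ φ₃` on `[0,T]`. -/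
theorem stmt4 (T : ℝ) (hT : 0 < T)
    (f h₃ : ℝ → ℝ) (hf : CadlagOn f T) (hh₃cad : CadlagOn h₃ T)
    (hh₃mono : MonotoneOn h₃ (Set.Icc 0 T)) (hh₃0 : 0 ≤ h₃ 0)
    (hφ₃ : ∀ t ∈ Set.Icc (0:ℝ) T, 0 ≤ f t + h₃ t) :
    ∀ t ∈ Set.Icc 0 T, skorohod1 f t ≤ f t + h₃ t := by
  rintro t ⟨ht0, htT⟩
  refine add_le_add_right (csSup_le ((nonempty_Icc.2 ht0).image _) ?_) (f t)
  rintro _ ⟨s, ⟨hs0, hst⟩, rfl⟩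
  have hs : s ∈ Set.Icc 0 T := ⟨hs0, hst.trans htT⟩
  have h0 : (0 : ℝ) ∈ Set.Icc 0 T := ⟨le_rfl, hT.le⟩
  have hs_nonneg : 0 ≤ h₃ s := hh₃0.trans (hh₃mono h0 hs hs0)
  have hs_neg : -f s ≤ h₃ s := neg_le_iff_add_nonneg'.2 (hφ₃ s hs)
  exact (max_le hs_neg hs_nonneg).trans (hh₃mono hs ⟨ht0, htT⟩ hst)
end

section
/- For any cadlag functions f₁, f₂ : [0,T] → ℝ one has sup_{t∈[0,T]} |Γ₁(f₁)(t) − Γ₁(f₂)(t)| ≤ 2 · sup_{t∈[0,T]} |f₁(t) − f₂(t)|; that is, the one-dimensional Skorohod map is Lipschitz with constant 2 in the uniform norm. -/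
open Set Filter

theorem eventually_abs_le_of_tendsto {l : Filter ℝ} {f : ℝ → ℝ} {L : ℝ}
    (h : Tendsto f l (nhds L)) : ∀ᶠ x in l, |f x| ≤ |L| + 1 :=
  h.abs.eventually_le_const (by linarith)

/-- A cadlag function on `[0,T]` is bounded there. -/
theorem CadlagOn.exists_abs_le {f : ℝ → ℝ} {T : ℝ} (hf : CadlagOn f T) :
    ∃ C, ∀ x ∈ Icc 0 T, |f x| ≤ C := by
  refine isCompact_Icc.induction_on (p := fun s => ∃ C, ∀ x ∈ s, |f x| ≤ C)
    ⟨0, by simp⟩ (fun s t hst ⟨C, hC⟩ => ⟨C, fun x hx => hC x (hst hx)⟩) ?_ ?_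
  · rintro s t ⟨C, hC⟩ ⟨D, hD⟩
    exact ⟨max C D, fun x hx => hx.elim (fun h => (hC x h).trans (le_max_left _ _))
      (fun h => (hD x h).trans (le_max_right _ _))⟩
  · intro t ht
    have hleft : ∃ C, ∀ᶠ x in nhds t, x < t → x ∈ Icc 0 T → |f x| ≤ C := by
      rcases ht.1.eq_or_lt with rfl | h0
      · exact ⟨0, .of_forall fun x hx hx' => absurd hx'.1 hx.not_ge⟩
      · obtain ⟨L, hL⟩ := hf.2 t ⟨h0, ht.2⟩
        refine ⟨|L| + 1, ?_⟩
        filter_upwards [eventually_nhdsWithin_iff.1 (eventually_abs_le_of_tendsto hL)]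
          with x hx h _ using hx h
    have hright : ∃ C, ∀ᶠ x in nhds t, t ≤ x → x ∈ Icc 0 T → |f x| ≤ C := by
      rcases ht.2.eq_or_lt with rfl | hT
      · exact ⟨|f t|, .of_forall fun x hx hx' => by rw [le_antisymm hx hx'.2]⟩
      · refine ⟨|f t| + 1, ?_⟩
        filter_upwards [eventually_nhdsWithin_iff.1
          (eventually_abs_le_of_tendsto (hf.1 t ⟨ht.1, hT⟩))] with x hx h _ using hx h
    obtain ⟨C, hC⟩ := hleft
    obtain ⟨D, hD⟩ := hright
    refine ⟨{x | |f x| ≤ max C D}, ?_, max C D, fun x hx => hx⟩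
    refine eventually_nhdsWithin_iff.2 ?_
    filter_upwards [hC, hD] with x h₁ h₂ hx
    rcases lt_or_ge x t with h | h
    · exact (h₁ h hx).trans (le_max_left _ _)
    · exact (h₂ h hx).trans (le_max_right _ _)

/-- If `g ≤ f + M` on `[0,t]` and `g` is bounded there, then the regulator of `f` exceeds
that of `g` by at most `M`. -/
theorem sSup_negPart_le_add {f g : ℝ → ℝ} {t M C : ℝ} (ht : 0 ≤ t) (hM : 0 ≤ M)
    (hg : ∀ s ∈ Icc 0 t, |g s| ≤ C) (h : ∀ s ∈ Icc 0 t, g s - f s ≤ M) :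
    sSup ((fun s => max (-f s) 0) '' Icc 0 t) ≤
      sSup ((fun s => max (-g s) 0) '' Icc 0 t) + M := by
  have hb : BddAbove ((fun s => max (-g s) 0) '' Icc 0 t) := by
    refine ⟨C, ?_⟩
    rintro _ ⟨s, hs, rfl⟩
    exact max_le ((neg_le_abs _).trans (hg s hs)) ((abs_nonneg _).trans (hg s hs))
  refine csSup_le ((nonempty_Icc.2 ht).image _) ?_
  rintro _ ⟨s, hs, rfl⟩
  have hle := le_csSup hb (mem_image_of_mem _ hs)
  have h₁ := h s hs
  have h₂ := le_max_left (-g s) 0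
  have h₃ := le_max_right (-g s) 0
  exact max_le (by linarith) (by linarith)

/-- The one-dimensional Skorohod map is Lipschitz with constant `2` in the uniform norm:
`sup_{t∈[0,T]} |Γ₁(f₁)(t) − Γ₁(f₂)(t)| ≤ 2 sup_{t∈[0,T]} |f₁(t) − f₂(t)|`. -/
theorem stmt6 (T : ℝ) (hT : 0 < T)
    (f₁ f₂ : ℝ → ℝ) (hf₁ : CadlagOn f₁ T) (hf₂ : CadlagOn f₂ T) :
    ∀ t ∈ Set.Icc (0:ℝ) T,
      |skorohod1 f₁ t - skorohod1 f₂ t| ≤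
        2 * sSup ((fun s => |f₁ s - f₂ s|) '' Set.Icc 0 T) := by
  intro t ht
  obtain ⟨C, hC⟩ := hf₁.exists_abs_le
  obtain ⟨D, hD⟩ := hf₂.exists_abs_le
  have hb : BddAbove ((fun s => |f₁ s - f₂ s|) '' Icc 0 T) := by
    refine ⟨C + D, ?_⟩
    rintro _ ⟨s, hs, rfl⟩
    exact (abs_sub _ _).trans (add_le_add (hC s hs) (hD s hs))
  have hM : ∀ s ∈ Icc 0 T, |f₁ s - f₂ s| ≤ sSup ((fun s => |f₁ s - f₂ s|) '' Icc 0 T) :=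
    fun s hs => le_csSup hb (mem_image_of_mem _ hs)
  generalize sSup ((fun s => |f₁ s - f₂ s|) '' Icc 0 T) = M at hM ⊢
  have hM0 : 0 ≤ M := (abs_nonneg _).trans (hM t ht)
  have hsub : ∀ s ∈ Icc 0 t, s ∈ Icc 0 T := fun s hs => ⟨hs.1, hs.2.trans ht.2⟩
  have h₁ := sSup_negPart_le_add (f := f₁) ht.1 hM0 (fun s hs => hD s (hsub s hs))
    (fun s hs => by linarith [neg_le_of_abs_le (hM s (hsub s hs))])
  have h₂ := sSup_negPart_le_add (f := f₂) ht.1 hM0 (fun s hs => hC s (hsub s hs))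
    (fun s hs => le_of_abs_le (hM s (hsub s hs)))
  have h₃ := abs_le.1 (hM t ht)
  unfold skorohod1
  exact abs_le.2 ⟨by linarith [h₃.1], by linarith [h₃.2]⟩
end

section
/- There exists a constant B ∈ (0,∞) such that for all w¹, w² ∈ ℝ₊^I with w¹_i ≥ w²_i for every i ∈ {1,…,I}, one has ĥ(w²) ≤ ĥ(w¹) + B·‖w¹ − w²‖₂, where ‖·‖₂ is the Euclidean norm. -/
open Matrix

/-- Euclidean norm on `ℝ^n`. -/
noncomputable def euclNorm {n : ℕ} (x : Fin n → ℝ) : ℝ :=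
  Real.sqrt (∑ i, x i ^ 2)

theorem kmVec_mul {I J : ℕ} (K : Matrix (Fin I) (Fin J) ℝ) {β : Fin J → ℝ}
    (hβ : ∀ j, 0 < β j) (x : Fin J → ℝ) :
    kmVec K β (fun j => β j * x j) = K *ᵥ x := by
  unfold kmVec
  congr 1
  ext j
  exact mul_div_cancel_left₀ _ (hβ j).ne.symm

/-- Flow that puts `u i` on the local route `f i` of each resource `i`. -/
def localFlow {I J : ℕ} (f : Fin I → Fin J) (u : Fin I → ℝ) : Fin J → ℝ :=
  fun j => ∑ i, if j = f i then u i else 0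

theorem localFlow_nonneg {I J : ℕ} (f : Fin I → Fin J) {u : Fin I → ℝ} (hu : ∀ i, 0 ≤ u i)
    (j : Fin J) : 0 ≤ localFlow f u j :=
  Finset.sum_nonneg fun i _ => by split_ifs <;> simp [hu]

theorem sum_mul_localFlow {I J : ℕ} (f : Fin I → Fin J) (u : Fin I → ℝ) (c : Fin J → ℝ) :
    ∑ j, c j * localFlow f u j = ∑ i, c (f i) * u i := by
  simp only [localFlow, Finset.mul_sum]
  rw [Finset.sum_comm]
  simp

theorem mulVec_localFlow {I J : ℕ} {K : Matrix (Fin I) (Fin J) ℝ} {f : Fin I → Fin J}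
    (hf : ∀ i, K i (f i) = 1 ∧ ∀ l, l ≠ i → K l (f i) = 0) (u : Fin I → ℝ) :
    K *ᵥ localFlow f u = u := by
  ext i
  rw [mulVec, dotProduct, sum_mul_localFlow, Finset.sum_eq_single i]
  · simp [(hf i).1]
  · intro l _ hl
    simp [(hf l).2 i hl.symm]
  · simp

theorem sum_le_card_mul_euclNorm {n : ℕ} (x : Fin n → ℝ) : ∑ i, x i ≤ n * euclNorm x := by
  have hx (i : Fin n) : x i ≤ euclNorm x :=
    Real.le_sqrt_of_sq_le
      (Finset.single_le_sum (f := fun i => x i ^ 2) (fun i _ => sq_nonneg _) (Finset.mem_univ i))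
  simpa using Finset.sum_le_card_nsmul Finset.univ x _ fun i _ => hx i

/-- Every flow with load `w₁` can be thinned to a smaller flow whose load is at most `w₂`, with
deficit at most the total decrease of the load. -/
theorem exists_thinned_flow {I J : ℕ} {K : Matrix (Fin I) (Fin J) ℝ}
    (hK01 : ∀ i j, K i j = 0 ∨ K i j = 1) {x : Fin J → ℝ} (hx : ∀ j, 0 ≤ x j)
    {w₁ w₂ : Fin I → ℝ} (hw₁ : ∀ i, 0 ≤ w₁ i) (hw₂ : ∀ i, 0 ≤ w₂ i) (hw : ∀ i, w₂ i ≤ w₁ i)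
    (hKx : K *ᵥ x = w₁) :
    ∃ y : Fin J → ℝ, (∀ j, 0 ≤ y j) ∧ (∀ j, y j ≤ x j) ∧
      ∀ i, (K *ᵥ y) i ≤ w₂ i ∧ w₂ i - (K *ᵥ y) i ≤ ∑ l, (w₁ l - w₂ l) := by
  have hK0 (i j) : 0 ≤ K i j := by rcases hK01 i j with e | e <;> simp [e]
  have hK1 (i j) : K i j ≤ 1 := by rcases hK01 i j with e | e <;> simp [e]
  have hsum (i : Fin I) : ∑ j, K i j * x j = w₁ i := congrFun hKx i
  set a : Fin I → ℝ := fun i => (w₁ i - w₂ i) / w₁ i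
  have ha0 (i) : 0 ≤ a i := div_nonneg (sub_nonneg.2 (hw i)) (hw₁ i)
  have ha1 (i) : a i ≤ 1 := div_le_one_of_le₀ (by linarith [hw₂ i]) (hw₁ i)
  have haw (i) : w₁ i * a i = w₁ i - w₂ i := by
    rcases (hw₁ i).eq_or_lt with e | e
    · have : w₂ i = 0 := le_antisymm (e ▸ hw i) (hw₂ i)
      simp [← e, this]
    · exact mul_div_cancel₀ _ e.ne.symm
  set t : Fin J → ℝ := fun j => max 0 (1 - ∑ l, K l j * a l)
  have hS (j) : 0 ≤ ∑ l, K l j * a l :=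
    Finset.sum_nonneg fun l _ => mul_nonneg (hK0 l j) (ha0 l)
  have ht0 (j) : 0 ≤ t j := le_max_left _ _
  have ht1 (j) : t j ≤ 1 := max_le zero_le_one (by linarith [hS j])
  have htK (i j) : K i j * t j ≤ K i j * (1 - a i) := by
    rcases hK01 i j with e | e
    · simp [e]
    · have h1 : K i j * a i ≤ ∑ l, K l j * a l :=
        Finset.single_le_sum (f := fun l => K l j * a l)
          (fun l _ => mul_nonneg (hK0 l j) (ha0 l)) (Finset.mem_univ i)
      rw [e, one_mul] at h1
      rw [e, one_mul, one_mul]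
      exact max_le (by linarith [ha1 i]) (by linarith)
  refine ⟨fun j => x j * t j, fun j => mul_nonneg (hx j) (ht0 j),
    fun j => mul_le_of_le_one_right (hx j) (ht1 j), fun i => ⟨?_, ?_⟩⟩
  · calc ∑ j, K i j * (x j * t j) ≤ ∑ j, K i j * x j * (1 - a i) :=
          Finset.sum_le_sum fun j _ => by nlinarith [mul_le_mul_of_nonneg_left (htK i j) (hx j)]
      _ = w₂ i := by
          rw [← Finset.sum_mul, hsum]
          linarith [haw i]
  · calc w₂ i - ∑ j, K i j * (x j * t j) ≤ w₁ i - ∑ j, K i j * (x j * t j) := by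
          linarith [hw i]
      _ = ∑ j, K i j * (x j * (1 - t j)) := by
          rw [← hsum i, ← Finset.sum_sub_distrib]
          exact Finset.sum_congr rfl fun j _ => by ring
      _ ≤ ∑ j, x j * ∑ l, K l j * a l := by
          refine Finset.sum_le_sum fun j _ => ?_
          have h1 : 1 - t j ≤ ∑ l, K l j * a l := by
            linarith [le_max_right 0 (1 - ∑ l, K l j * a l)]
          exact (mul_le_of_le_one_left
            (mul_nonneg (hx j) (sub_nonneg.2 (ht1 j))) (hK1 i j)).trans
            (mul_le_mul_of_nonneg_left h1 (hx j))
      _ = ∑ l, (w₁ l - w₂ l) := by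
          simp only [Finset.mul_sum]
          rw [Finset.sum_comm]
          refine Finset.sum_congr rfl fun l _ => ?_
          rw [← haw l, ← hsum l, Finset.sum_mul]
          exact Finset.sum_congr rfl fun j _ => by ring

theorem hhat_le {I J : ℕ} {K : Matrix (Fin I) (Fin J) ℝ} {β h : Fin J → ℝ}
    (hh : ∀ j, 0 < h j) {w : Fin I → ℝ} {q : Fin J → ℝ} (hq : ∀ j, 0 ≤ q j)
    (hqw : kmVec K β q = w) : hhat K β h w ≤ h ⬝ᵥ q := by
  refine csInf_le ⟨0, ?_⟩ ⟨q, hq, hqw, rfl⟩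
  rintro _ ⟨p, hp, -, rfl⟩
  exact Finset.sum_nonneg fun j _ => mul_nonneg (hh j).le (hp j)

/-- There is `B ∈ (0,∞)` such that `ĥ(w²) ≤ ĥ(w¹) + B‖w¹ − w²‖₂` whenever
`w¹ ≥ w² ≥ 0` componentwise. -/
theorem stmt10 (I J : ℕ) (hI : 0 < I) (hJ : 0 < J)
    (K : Matrix (Fin I) (Fin J) ℝ)
    (hK01 : ∀ i j, K i j = 0 ∨ K i j = 1)
    (hcol : ∀ j, ∃ i, K i j = 1)
    (hloc : ∀ i, ∃ j, K i j = 1 ∧ ∀ l, l ≠ i → K l j = 0)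
    (β : Fin J → ℝ) (hβ : ∀ j, 0 < β j)
    (h : Fin J → ℝ) (hh : ∀ j, 0 < h j) :
    ∃ B : ℝ, 0 < B ∧
      ∀ w₁ w₂ : Fin I → ℝ, (∀ i, 0 ≤ w₁ i) → (∀ i, 0 ≤ w₂ i) → (∀ i, w₂ i ≤ w₁ i) →
        hhat K β h w₂ ≤ hhat K β h w₁ + B * euclNorm (fun i => w₁ i - w₂ i) := by
  choose f hf using hloc
  have hc (j) : 0 < h j * β j := mul_pos (hh j) (hβ j)
  have hC : 0 < ∑ i, h (f i) * β (f i) :=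
    Finset.sum_pos (fun i _ => hc (f i)) ⟨⟨0, hI⟩, Finset.mem_univ _⟩
  refine ⟨(∑ i, h (f i) * β (f i)) * I, mul_pos hC (Nat.cast_pos.2 hI), ?_⟩
  intro w₁ w₂ hw₁ hw₂ hw
  rw [← sub_le_iff_le_add]
  refine le_csInf ⟨_, fun j => β j * localFlow f w₁ j,
    fun j => mul_nonneg (hβ j).le (localFlow_nonneg f hw₁ j),
    by rw [kmVec_mul K hβ, mulVec_localFlow hf], rfl⟩ ?_
  rintro _ ⟨q, hq, hqw, rfl⟩
  obtain ⟨y, hy0, hyx, hy⟩ := exists_thinned_flow hK01 (x := fun j => q j / β j)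
    (fun j => div_nonneg (hq j) (hβ j).le) hw₁ hw₂ hw hqw
  set u : Fin I → ℝ := fun i => w₂ i - (K *ᵥ y) i with hu
  have hu0 (i) : 0 ≤ u i := sub_nonneg.2 (hy i).1
  have hle := hhat_le (K := K) (β := β) (w := w₂) hh
    (q := fun j => β j * (y + localFlow f u) j)
    (fun j => mul_nonneg (hβ j).le (add_nonneg (hy0 j) (localFlow_nonneg f hu0 j)))
    (by
      rw [kmVec_mul K hβ, mulVec_add, mulVec_localFlow hf]
      ext i
      simp [hu])
  rw [sub_le_iff_le_add]
  refine hle.trans ?_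
  have hsplit : (h ⬝ᵥ fun j => β j * (y + localFlow f u) j) =
      ∑ j, h j * (β j * y j) + ∑ i, h (f i) * β (f i) * u i := by
    rw [← sum_mul_localFlow f u fun j => h j * β j, ← Finset.sum_add_distrib]
    exact Finset.sum_congr rfl fun j _ => by simp only [Pi.add_apply]; ring
  rw [hsplit]
  refine add_le_add (Finset.sum_le_sum fun j _ => mul_le_mul_of_nonneg_left ?_ (hh j).le) ?_
  · exact (le_div_iff₀' (hβ j)).1 (hyx j)
  · rw [mul_assoc, Finset.sum_mul]
    exact Finset.sum_le_sum fun i _ => mul_le_mul_of_nonneg_left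
      ((hy i).2.trans (sum_le_card_mul_euclNorm _)) (hc (f i)).le
end

section
/- There exists a constant B̂ ∈ (0,∞) such that |ĥ(w¹) − ĥ(w²)| ≤ B̂·‖w¹ − w²‖₂ for all w¹, w² ∈ ℝ₊^I; that is, ĥ is Lipschitz on ℝ₊^I with respect to the Euclidean norm. -/
open Matrix

lemma abs_le_euclNorm {n : ℕ} (x : Fin n → ℝ) (i : Fin n) : |x i| ≤ euclNorm x :=
  Real.abs_le_sqrt (Finset.single_le_sum (f := fun i => x i ^ 2)
    (fun i _ => sq_nonneg (x i)) (Finset.mem_univ i))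

lemma sum_abs_le_mul_euclNorm {n : ℕ} (x : Fin n → ℝ) : ∑ i, |x i| ≤ n * euclNorm x := by
  simpa using Finset.sum_le_card_nsmul Finset.univ (fun i => |x i|) (euclNorm x)
    fun i _ => abs_le_euclNorm x i

lemma kmVec_apply {I J : ℕ} (K : Matrix (Fin I) (Fin J) ℝ) (β q : Fin J → ℝ) (i : Fin I) :
    kmVec K β q i = ∑ j, K i j * (q j / β j) := rfl

lemma kmVec_add {I J : ℕ} (K : Matrix (Fin I) (Fin J) ℝ) (β p q : Fin J → ℝ) :
    kmVec K β (p + q) = kmVec K β p + kmVec K β q := by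
  ext i
  simp [kmVec_apply, add_div, mul_add, Finset.sum_add_distrib]

/-- Local traffic serves any nonnegative load `r` at a cost linear in `r`. -/
lemma exists_kmVec_eq_of_local {I J : ℕ} {K : Matrix (Fin I) (Fin J) ℝ} {β : Fin J → ℝ}
    (hβ : ∀ j, 0 < β j) (h : Fin J → ℝ) {σ : Fin I → Fin J}
    (hσ : ∀ i, K i (σ i) = 1 ∧ ∀ l, l ≠ i → K l (σ i) = 0)
    {r : Fin I → ℝ} (hr : ∀ i, 0 ≤ r i) :
    ∃ q : Fin J → ℝ, (∀ j, 0 ≤ q j) ∧ kmVec K β q = r ∧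
      h ⬝ᵥ q = ∑ i, h (σ i) * β (σ i) * r i := by
  refine ⟨fun j => ∑ i, if σ i = j then β j * r i else 0, fun j => ?_, ?_, ?_⟩
  · refine Finset.sum_nonneg fun i _ => ?_
    split_ifs
    · exact mul_nonneg (hβ j).le (hr i)
    · exact le_rfl
  · ext l
    simp only [kmVec_apply, Finset.sum_div, Finset.mul_sum]
    rw [Finset.sum_comm]
    have key : ∀ i, ∑ j, K l j * ((if σ i = j then β j * r i else 0) / β j) =
        if l = i then r i else 0 := by
      intro i
      rw [Finset.sum_eq_single (σ i) (by intro j _ hj; simp [hj.symm]) (by simp)]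
      have hne := (hβ (σ i)).ne'
      rw [if_pos rfl]
      split_ifs with hli
      · subst hli
        simp [(hσ l).1, hne]
      · simp [(hσ i).2 l hli]
    simp [key]
  · simp only [dotProduct, Finset.mul_sum]
    rw [Finset.sum_comm]
    simp [mul_assoc]

/-- A flow serving `w₂` can be scaled down to serve at most `w₁`, falling short of `w₁` by at
most a multiple of the `ℓ¹` distance between `w₁` and `w₂`. -/
lemma exists_le_kmVec_le {I J : ℕ} {K : Matrix (Fin I) (Fin J) ℝ}
    (hK01 : ∀ i j, K i j = 0 ∨ K i j = 1) {β : Fin J → ℝ} (hβ : ∀ j, 0 < β j)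
    {w₁ w₂ : Fin I → ℝ} (hw₁ : ∀ i, 0 ≤ w₁ i) (hw₂ : ∀ i, 0 ≤ w₂ i)
    {q : Fin J → ℝ} (hq : ∀ j, 0 ≤ q j) (hqw : kmVec K β q = w₂) :
    ∃ p : Fin J → ℝ, (∀ j, 0 ≤ p j) ∧ (∀ j, p j ≤ q j) ∧ (∀ i, kmVec K β p i ≤ w₁ i) ∧
      ∀ i, w₁ i - kmVec K β p i ≤ 2 * ∑ l, |w₁ l - w₂ l| := by
  have hK : ∀ i j, 0 ≤ K i j := fun i j => by rcases hK01 i j with e | e <;> simp [e]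
  set s : Fin I → ℝ := fun l => max 0 (w₂ l - w₁ l) / w₂ l
  have hs : ∀ l, 0 ≤ s l := fun l => div_nonneg (le_max_left _ _) (hw₂ l)
  have hsw : ∀ l, s l * w₂ l = max 0 (w₂ l - w₁ l) := by
    intro l
    rcases (hw₂ l).eq_or_lt with e | e
    · rw [← e, mul_zero, max_eq_left (by linarith [hw₁ l])]
    · exact div_mul_cancel₀ _ e.ne'
  have hs1 : ∀ l, s l ≤ 1 := fun l =>
    div_le_one_of_le₀ (max_le (hw₂ l) (by linarith [hw₁ l])) (hw₂ l)
  have hKs : ∀ j, 0 ≤ ∑ l, K l j * s l := fun j =>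
    Finset.sum_nonneg fun l _ => mul_nonneg (hK l j) (hs l)
  have hw : ∀ i, ∑ j, K i j * (q j / β j) = w₂ i := fun i => congrFun hqw i
  have hqβ : ∀ j, 0 ≤ q j / β j := fun j => div_nonneg (hq j) (hβ j).le
  refine ⟨fun j => q j * max 0 (1 - ∑ l, K l j * s l),
    fun j => mul_nonneg (hq j) (le_max_left _ _),
    fun j => mul_le_of_le_one_right (hq j) (max_le zero_le_one (by linarith [hKs j])),
    fun i => ?_, fun i => ?_⟩
  · have hle : kmVec K β (fun j => q j * max 0 (1 - ∑ l, K l j * s l)) i ≤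
        ∑ j, (1 - s i) * (K i j * (q j / β j)) := by
      rw [kmVec_apply]
      refine Finset.sum_le_sum fun j _ => ?_
      rcases hK01 i j with e | e
      · simp [e]
      · have h1 : s i ≤ ∑ l, K l j * s l := by
          simpa [e] using Finset.single_le_sum (f := fun l => K l j * s l)
            (fun l _ => mul_nonneg (hK l j) (hs l)) (Finset.mem_univ i)
        have h2 : max 0 (1 - ∑ l, K l j * s l) ≤ 1 - s i :=
          max_le (by linarith [hs1 i]) (by linarith)
        rw [e, mul_div_right_comm, one_mul, one_mul, mul_comm]
        exact mul_le_mul_of_nonneg_right h2 (hqβ j)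
    rw [← Finset.mul_sum, hw, sub_mul, hsw] at hle
    linarith [le_max_right 0 (w₂ i - w₁ i)]
  · have hle : w₂ i - ∑ l, s l * w₂ l ≤
        kmVec K β (fun j => q j * max 0 (1 - ∑ l, K l j * s l)) i := by
      have hsum : ∑ l, s l * w₂ l = ∑ j, (q j / β j) * ∑ l, K l j * s l := by
        simp_rw [← hw, Finset.mul_sum]
        rw [Finset.sum_comm]
        exact Finset.sum_congr rfl fun j _ => Finset.sum_congr rfl fun l _ => by ring
      rw [hsum, ← hw i, ← Finset.sum_sub_distrib, kmVec_apply]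
      refine Finset.sum_le_sum fun j _ => ?_
      have h0 := mul_nonneg (hqβ j) (hKs j)
      have h1 := mul_le_mul_of_nonneg_left (le_max_right 0 (1 - ∑ l, K l j * s l)) (hqβ j)
      rw [mul_div_right_comm]
      rcases hK01 i j with e | e
      · simpa [e] using h0
      · rw [e]
        linarith
    have hD : ∑ l, s l * w₂ l ≤ ∑ l, |w₁ l - w₂ l| :=
      Finset.sum_le_sum fun l _ => by
        rw [hsw, abs_sub_comm]
        exact max_le (abs_nonneg _) (le_abs_self _)
    have hi : |w₁ i - w₂ i| ≤ ∑ l, |w₁ l - w₂ l| :=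
      Finset.single_le_sum (f := fun l => |w₁ l - w₂ l|) (fun l _ => abs_nonneg _)
        (Finset.mem_univ i)
    linarith [le_abs_self (w₁ i - w₂ i)]

lemma exists_kmVec_eq_cost_le {I J : ℕ} {K : Matrix (Fin I) (Fin J) ℝ}
    (hK01 : ∀ i j, K i j = 0 ∨ K i j = 1) {β h : Fin J → ℝ}
    (hβ : ∀ j, 0 < β j) (hh : ∀ j, 0 ≤ h j) {σ : Fin I → Fin J}
    (hσ : ∀ i, K i (σ i) = 1 ∧ ∀ l, l ≠ i → K l (σ i) = 0)
    {w₁ w₂ : Fin I → ℝ} (hw₁ : ∀ i, 0 ≤ w₁ i) (hw₂ : ∀ i, 0 ≤ w₂ i)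
    {q : Fin J → ℝ} (hq : ∀ j, 0 ≤ q j) (hqw : kmVec K β q = w₂) :
    ∃ p : Fin J → ℝ, (∀ j, 0 ≤ p j) ∧ kmVec K β p = w₁ ∧
      h ⬝ᵥ p ≤ h ⬝ᵥ q + (∑ i, h (σ i) * β (σ i)) * (2 * ∑ l, |w₁ l - w₂ l|) := by
  obtain ⟨p, hp, hpq, hpw, hdef⟩ := exists_le_kmVec_le hK01 hβ hw₁ hw₂ hq hqw
  obtain ⟨p', hp', hpw', hcost⟩ := exists_kmVec_eq_of_local hβ h hσ
    (r := w₁ - kmVec K β p) fun i => sub_nonneg.2 (hpw i)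
  refine ⟨p + p', fun j => add_nonneg (hp j) (hp' j), by rw [kmVec_add, hpw']; abel, ?_⟩
  rw [dotProduct_add, hcost, Finset.sum_mul]
  exact add_le_add
    (Finset.sum_le_sum fun j _ => mul_le_mul_of_nonneg_left (hpq j) (hh j))
    (Finset.sum_le_sum fun i _ =>
      mul_le_mul_of_nonneg_left (hdef i) (mul_nonneg (hh _) (hβ _).le))

lemma hhat_le_hhat_add {I J : ℕ} {K : Matrix (Fin I) (Fin J) ℝ}
    (hK01 : ∀ i j, K i j = 0 ∨ K i j = 1) {β h : Fin J → ℝ}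
    (hβ : ∀ j, 0 < β j) (hh : ∀ j, 0 ≤ h j) {σ : Fin I → Fin J}
    (hσ : ∀ i, K i (σ i) = 1 ∧ ∀ l, l ≠ i → K l (σ i) = 0)
    {w₁ w₂ : Fin I → ℝ} (hw₁ : ∀ i, 0 ≤ w₁ i) (hw₂ : ∀ i, 0 ≤ w₂ i) :
    hhat K β h w₁ ≤
      hhat K β h w₂ + (∑ i, h (σ i) * β (σ i)) * (2 * ∑ l, |w₁ l - w₂ l|) := by
  rw [← sub_le_iff_le_add]
  obtain ⟨q₀, hq₀, hqw₀, -⟩ := exists_kmVec_eq_of_local hβ h hσ hw₂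
  refine le_csInf ⟨_, q₀, hq₀, hqw₀, rfl⟩ ?_
  rintro x ⟨q, hq, hqw, rfl⟩
  obtain ⟨p, hp, hpw, hle⟩ := exists_kmVec_eq_cost_le hK01 hβ hh hσ hw₁ hw₂ hq hqw
  rw [sub_le_iff_le_add]
  refine le_trans (csInf_le ⟨0, ?_⟩ ⟨p, hp, hpw, rfl⟩) hle
  rintro x ⟨q, hq, -, rfl⟩
  exact Finset.sum_nonneg fun j _ => mul_nonneg (hh j) (hq j)

/-- `ĥ` is Lipschitz on `ℝ₊^I` for the Euclidean norm. -/
theorem stmt11 (I J : ℕ) (hI : 0 < I) (hJ : 0 < J)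
    (K : Matrix (Fin I) (Fin J) ℝ)
    (hK01 : ∀ i j, K i j = 0 ∨ K i j = 1)
    (hcol : ∀ j, ∃ i, K i j = 1)
    (hloc : ∀ i, ∃ j, K i j = 1 ∧ ∀ l, l ≠ i → K l j = 0)
    (β : Fin J → ℝ) (hβ : ∀ j, 0 < β j)
    (h : Fin J → ℝ) (hh : ∀ j, 0 < h j) :
    ∃ B : ℝ, 0 < B ∧
      ∀ w₁ w₂ : Fin I → ℝ, (∀ i, 0 ≤ w₁ i) → (∀ i, 0 ≤ w₂ i) →
        |hhat K β h w₁ - hhat K β h w₂| ≤ B * euclNorm (fun i => w₁ i - w₂ i) := by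
  choose σ hσ using hloc
  set C := ∑ i, h (σ i) * β (σ i)
  have hC : 0 ≤ C := Finset.sum_nonneg fun i _ => (mul_pos (hh _) (hβ _)).le
  refine ⟨C * (2 * I) + 1, by positivity, fun w₁ w₂ hw₁ hw₂ => ?_⟩
  have h₁₂ := hhat_le_hhat_add hK01 hβ (fun j => (hh j).le) hσ hw₁ hw₂
  have h₂₁ := hhat_le_hhat_add hK01 hβ (fun j => (hh j).le) hσ hw₂ hw₁
  simp_rw [abs_sub_comm (w₂ _)] at h₂₁
  have hN : 0 ≤ euclNorm fun i => w₁ i - w₂ i := Real.sqrt_nonneg _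
  have hD := mul_le_mul_of_nonneg_left (sum_abs_le_mul_euclNorm fun i => w₁ i - w₂ i) hC
  rw [abs_sub_le_iff]
  constructor <;> linarith
end

section
/- There exists a constant B ∈ (0,∞) such that |d̃(q¹) − d̃(q²)| ≤ B·‖q¹ − q²‖₂ for all q¹, q² ∈ ℝ₊^J; that is, d̃ is Lipschitz on ℝ₊^J with respect to the Euclidean norm. -/
open Matrix

/-- A nonnegative solution of `K x = b` can be moved to a nonnegative solution of `K x = b'`, at a
distance proportional to a bound on `b - b'`. -/
lemma exists_nonneg_solution_near {I J : ℕ} (K : Matrix (Fin I) (Fin J) ℝ)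
    (hK01 : ∀ i j, K i j = 0 ∨ K i j = 1)
    (hloc : ∀ i, ∃ j, K i j = 1 ∧ ∀ l, l ≠ i → K l j = 0)
    (x : Fin J → ℝ) (hx : ∀ j, 0 ≤ x j) (b : Fin I → ℝ) (hb : ∀ i, 0 ≤ b i)
    (E : ℝ) (hE : ∀ i, |K.mulVec x i - b i| ≤ E) (hE0 : 0 ≤ E) :
    ∃ y : Fin J → ℝ, (∀ j, 0 ≤ y j) ∧ K.mulVec y = b ∧
      ∀ j, |y j - x j| ≤ (1 + I * (1 + J)) * E := by
  choose loc hloc1 hloc0 using hloc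
  have hK0 : ∀ i j, 0 ≤ K i j := fun i j => by rcases hK01 i j with h | h <;> simp [h]
  have hK1 : ∀ i j, K i j ≤ 1 := fun i j => by rcases hK01 i j with h | h <;> simp [h]
  set z : Fin J → ℝ := fun j => max (x j - E) 0 with hz
  have hz0 : ∀ j, 0 ≤ z j := fun j => le_max_right _ _
  have hzx : ∀ j, z j ≤ x j := fun j => max_le (by linarith) (hx j)
  have hxz : ∀ j, x j - E ≤ z j := fun j => le_max_left _ _
  set f : Fin I → ℝ := fun i => b i - K.mulVec z i with hf
  have hf0 : ∀ i, 0 ≤ f i := by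
    intro i
    have hEi := (abs_le.1 (hE i)).2
    simp only [hf, sub_nonneg]
    by_cases hex : ∃ j, K i j = 1 ∧ E ≤ x j
    · obtain ⟨j, hj1, hj⟩ := hex
      have hsum : E ≤ ∑ k, K i k * (x k - z k) := by
        have hzj : z j = x j - E := max_eq_left (by linarith)
        have := Finset.single_le_sum (f := fun k => K i k * (x k - z k))
          (fun k _ => mul_nonneg (hK0 i k) (sub_nonneg.2 (hzx k))) (Finset.mem_univ j)
        simp only [hj1, hzj] at this
        linarith
      simp only [mul_sub, Finset.sum_sub_distrib] at hsum
      simp only [Matrix.mulVec, dotProduct] at hEi ⊢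
      linarith
    · push Not at hex
      have : K.mulVec z i = 0 := by
        simp only [Matrix.mulVec, dotProduct]
        refine Finset.sum_eq_zero fun j _ => ?_
        rcases hK01 i j with h | h
        · simp [h]
        · have : z j = 0 := max_eq_right (by linarith [hex j h])
          simp [this]
      rw [this]
      exact hb i
  have hfE : ∀ i, f i ≤ (1 + J) * E := by
    intro i
    have hEi := (abs_le.1 (hE i)).1
    have hsum : ∑ k, K i k * (x k - z k) ≤ ∑ _k : Fin J, E :=
      Finset.sum_le_sum fun k _ => by nlinarith [hK0 i k, hK1 i k, hxz k, hzx k]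
    simp only [mul_sub, Finset.sum_sub_distrib, Finset.sum_const, Finset.card_univ,
      Fintype.card_fin, nsmul_eq_mul] at hsum
    simp only [hf]
    simp only [Matrix.mulVec, dotProduct] at hEi ⊢
    linarith
  have hterm : ∀ j l, 0 ≤ (if loc l = j then f l else 0) := fun j l => by
    split_ifs <;> simp [hf0]
  refine ⟨fun j => z j + ∑ l, if loc l = j then f l else 0,
    fun j => add_nonneg (hz0 j) (Finset.sum_nonneg fun l _ => hterm j l), ?_, ?_⟩
  · ext i
    have hfill : ∑ j, K i j * ∑ l, (if loc l = j then f l else 0) = f i := by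
      simp only [Finset.mul_sum]
      rw [Finset.sum_comm]
      simp only [mul_ite, mul_zero, Finset.sum_ite_eq, Finset.mem_univ, if_true]
      rw [Finset.sum_eq_single i]
      · rw [hloc1, one_mul]
      · intro l _ hl
        rw [hloc0 l i hl.symm, zero_mul]
      · simp
    simp only [Matrix.mulVec, dotProduct, mul_add, Finset.sum_add_distrib]
    rw [hfill]
    simp only [hf, Matrix.mulVec, dotProduct]
    ring
  · intro j
    have hs0 := Finset.sum_nonneg fun l (_ : l ∈ Finset.univ) => hterm j l
    have hs : ∑ l, (if loc l = j then f l else 0) ≤ ∑ _l : Fin I, (1 + J) * E :=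
      Finset.sum_le_sum fun l _ => by
        split_ifs
        · exact hfE l
        · positivity
    simp only [Finset.sum_const, Finset.card_univ, Fintype.card_fin, nsmul_eq_mul] at hs
    have : (0 : ℝ) ≤ I * ((1 + J) * E) := by positivity
    rw [abs_le]
    constructor <;> nlinarith [hzx j, hxz j]

/-- The feasible set `{v ∈ ker K : q + βv ≥ 0}` depends on `q` in a Lipschitz way. -/
lemma exists_feasible_near {I J : ℕ} (K : Matrix (Fin I) (Fin J) ℝ)
    (hK01 : ∀ i j, K i j = 0 ∨ K i j = 1)
    (hloc : ∀ i, ∃ j, K i j = 1 ∧ ∀ l, l ≠ i → K l j = 0)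
    (β : Fin J → ℝ) (hβ : ∀ j, 0 < β j) :
    ∃ C : ℝ, 0 ≤ C ∧ ∀ q₁ q₂ : Fin J → ℝ, (∀ j, 0 ≤ q₂ j) →
      ∀ v : Fin J → ℝ, K.mulVec v = 0 → (∀ j, 0 ≤ q₁ j + β j * v j) →
        ∃ w : Fin J → ℝ, K.mulVec w = 0 ∧ (∀ j, 0 ≤ q₂ j + β j * w j) ∧
          ∀ j, |v j - w j| ≤ C * euclNorm (fun j => q₁ j - q₂ j) := by
  have hr : 0 ≤ ∑ j, (β j)⁻¹ := Finset.sum_nonneg fun j _ => (inv_pos.2 (hβ j)).le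
  refine ⟨(1 + (1 + I * (1 + J))) * ∑ j, (β j)⁻¹, by positivity, ?_⟩
  intro q₁ q₂ hq₂ v hv hfeas
  set D := euclNorm (fun j => q₁ j - q₂ j)
  have hD : ∀ j, |q₁ j - q₂ j| ≤ D := abs_le_euclNorm fun j => q₁ j - q₂ j
  have hD0 : 0 ≤ D := Real.sqrt_nonneg _
  have hK0 : ∀ i j, 0 ≤ K i j := fun i j => by rcases hK01 i j with h | h <;> simp [h]
  have hK1 : ∀ i j, K i j ≤ 1 := fun i j => by rcases hK01 i j with h | h <;> simp [h]
  set p₁ : Fin J → ℝ := fun j => q₁ j / β j with hp₁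
  set p₂ : Fin J → ℝ := fun j => q₂ j / β j with hp₂
  have hp : ∀ j, |p₁ j - p₂ j| ≤ (β j)⁻¹ * D := fun j => by
    simp only [hp₁, hp₂]
    rw [← sub_div, abs_div, abs_of_pos (hβ j), div_eq_inv_mul]
    exact mul_le_mul_of_nonneg_left (hD j) (inv_pos.2 (hβ j)).le
  have hp' : ∀ j, |p₁ j - p₂ j| ≤ (∑ j, (β j)⁻¹) * D := fun j =>
    (hp j).trans <| mul_le_mul_of_nonneg_right
      (Finset.single_le_sum (f := fun j => (β j)⁻¹)
        (fun j _ => (inv_pos.2 (hβ j)).le) (Finset.mem_univ j)) hD0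
  obtain ⟨y, hy0, hyK, hy⟩ := exists_nonneg_solution_near K hK01 hloc (v + p₁)
    (fun j => by
      have : v j + q₁ j / β j = (q₁ j + β j * v j) / β j := by
        field_simp [(hβ j).ne']
        ring
      simp only [Pi.add_apply, hp₁, this]
      exact div_nonneg (hfeas j) (hβ j).le)
    (K.mulVec p₂)
    (fun i => dotProduct_nonneg_of_nonneg (hK0 i) fun j => div_nonneg (hq₂ j) (hβ j).le)
    ((∑ j, (β j)⁻¹) * D)
    (fun i => by
      rw [Matrix.mulVec_add, hv, zero_add]
      simp only [Matrix.mulVec, dotProduct]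
      rw [← Finset.sum_sub_distrib, Finset.sum_mul]
      refine (Finset.abs_sum_le_sum_abs _ _).trans (Finset.sum_le_sum fun j _ => ?_)
      rw [← mul_sub, abs_mul, abs_of_nonneg (hK0 i j)]
      exact (mul_le_of_le_one_left (abs_nonneg _) (hK1 i j)).trans (hp j))
    (mul_nonneg hr hD0)
  refine ⟨y - p₂, by rw [Matrix.mulVec_sub, hyK, sub_self], fun j => ?_, fun j => ?_⟩
  · have : q₂ j + β j * (y j - q₂ j / β j) = β j * y j := by
      field_simp [(hβ j).ne']
      ring
    simp only [Pi.sub_apply, hp₂, this]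
    exact mul_nonneg (hβ j).le (hy0 j)
  · have h1 := abs_le.1 (hy j)
    have h2 := abs_le.1 (hp' j)
    simp only [Pi.add_apply, Pi.sub_apply] at h1 ⊢
    rw [abs_le]
    constructor <;> linarith

/-- The feasible set `{v ∈ ker K : q + βv ≥ 0}` is bounded in every coordinate. -/
lemma exists_feasible_bound {I J : ℕ} (K : Matrix (Fin I) (Fin J) ℝ)
    (hK01 : ∀ i j, K i j = 0 ∨ K i j = 1) (hcol : ∀ j, ∃ i, K i j = 1)
    (β : Fin J → ℝ) (hβ : ∀ j, 0 < β j) (q : Fin J → ℝ) :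
    ∃ R : ℝ, ∀ v : Fin J → ℝ, K.mulVec v = 0 → (∀ j, 0 ≤ q j + β j * v j) →
      ∀ j, |v j| ≤ R := by
  refine ⟨∑ k, |q k / β k|, fun v hv hfeas j => ?_⟩
  have hlow : ∀ k, -|q k / β k| ≤ v k := fun k => by
    have h1 : -(q k / β k) ≤ v k := by
      rw [← neg_div, div_le_iff₀ (hβ k)]
      linarith [hfeas k]
    linarith [le_abs_self (q k / β k)]
  have hsingle : |q j / β j| ≤ ∑ k, |q k / β k| :=
    Finset.single_le_sum (f := fun k => |q k / β k|) (fun _ _ => abs_nonneg _)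
      (Finset.mem_univ j)
  rw [abs_le]
  refine ⟨by linarith [hlow j], ?_⟩
  obtain ⟨i, hi⟩ := hcol j
  have hrow : ∑ k, K i k * v k = 0 := congrFun hv i
  have := Finset.single_le_sum (f := fun k => K i k * v k + |q k / β k|)
    (fun k _ => by
      rcases hK01 i k with h | h
      · simp [h]
      · rw [h]
        linarith [hlow k]) (Finset.mem_univ j)
  rw [Finset.sum_add_distrib, hrow, hi] at this
  linarith [abs_nonneg (q j / β j)]

lemma abs_dotProduct_le_of_forall_abs_le {n : ℕ} (v u : Fin n → ℝ) (R : ℝ)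
    (hv : ∀ j, |v j| ≤ R) : |v ⬝ᵥ u| ≤ R * ∑ j, |u j| := by
  rw [Finset.mul_sum]
  refine (Finset.abs_sum_le_sum_abs _ _).trans (Finset.sum_le_sum fun j _ => ?_)
  rw [abs_mul]
  exact mul_le_mul_of_nonneg_right (hv j) (abs_nonneg _)

/-- `d̃` is Lipschitz on `ℝ₊^J` for the Euclidean norm. -/
theorem stmt13 (I J : ℕ) (hI : 0 < I) (hJ : 0 < J)
    (K : Matrix (Fin I) (Fin J) ℝ)
    (hK01 : ∀ i j, K i j = 0 ∨ K i j = 1)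
    (hcol : ∀ j, ∃ i, K i j = 1)
    (hloc : ∀ i, ∃ j, K i j = 1 ∧ ∀ l, l ≠ i → K l j = 0)
    (β : Fin J → ℝ) (hβ : ∀ j, 0 < β j)
    (h : Fin J → ℝ) (hh : ∀ j, 0 < h j)
    (hC : {u : Fin J → ℝ | K.mulVec u = 0 ∧ (fun j => h j * β j) ⬝ᵥ u = 0} ≠
          {u : Fin J → ℝ | K.mulVec u = 0})
    (ustar : Fin J → ℝ)
    (hker : K.mulVec ustar = 0)
    (hunit : ∑ j, ustar j ^ 2 = 1)
    (horth : ∀ u : Fin J → ℝ, K.mulVec u = 0 → (fun j => h j * β j) ⬝ᵥ u = 0 →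
      u ⬝ᵥ ustar = 0)
    (hneg : (fun j => h j * β j) ⬝ᵥ ustar < 0) :
    ∃ B : ℝ, 0 < B ∧
      ∀ q₁ q₂ : Fin J → ℝ, (∀ j, 0 ≤ q₁ j) → (∀ j, 0 ≤ q₂ j) →
        |dtilde K β ustar q₁ - dtilde K β ustar q₂| ≤
          B * euclNorm (fun j => q₁ j - q₂ j) := by
  obtain ⟨C, hC0, hnear⟩ := exists_feasible_near K hK01 hloc β hβ
  have hU : 0 ≤ ∑ j, |ustar j| := Finset.sum_nonneg fun _ _ => abs_nonneg _
  have key : ∀ q₁ q₂ : Fin J → ℝ, (∀ j, 0 ≤ q₁ j) → (∀ j, 0 ≤ q₂ j) →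
      dtilde K β ustar q₁ ≤ dtilde K β ustar q₂ +
        (C * ∑ j, |ustar j| + 1) * euclNorm (fun j => q₁ j - q₂ j) := by
    intro q₁ q₂ hq₁ hq₂
    refine csSup_le ⟨0, 0, by simp, by simpa using hq₁, by simp⟩ ?_
    rintro _ ⟨v, hv, hfeas, rfl⟩
    obtain ⟨w, hw, hwfeas, hvw⟩ := hnear q₁ q₂ hq₂ v hv hfeas
    have hle : w ⬝ᵥ ustar ≤ dtilde K β ustar q₂ := by
      obtain ⟨R, hR⟩ := exists_feasible_bound K hK01 hcol β hβ q₂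
      refine le_csSup ⟨R * ∑ j, |ustar j|, ?_⟩ ⟨w, hw, hwfeas, rfl⟩
      rintro _ ⟨y, hy, hyfeas, rfl⟩
      exact (le_abs_self _).trans
        (abs_dotProduct_le_of_forall_abs_le y ustar R (hR y hy hyfeas))
    have hdiff := (le_abs_self _).trans
      (abs_dotProduct_le_of_forall_abs_le (v - w) ustar _ hvw)
    rw [sub_dotProduct] at hdiff
    have hnorm : 0 ≤ euclNorm (fun j => q₁ j - q₂ j) := Real.sqrt_nonneg _
    linarith
  refine ⟨C * ∑ j, |ustar j| + 1, by positivity, fun q₁ q₂ hq₁ hq₂ => ?_⟩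
  have hsymm : euclNorm (fun j => q₂ j - q₁ j) = euclNorm (fun j => q₁ j - q₂ j) := by
    simp only [euclNorm, sub_sq_comm]
  have h₁₂ := key q₁ q₂ hq₁ hq₂
  have h₂₁ := key q₂ q₁ hq₂ hq₁
  rw [hsymm] at h₂₁
  rw [abs_le]
  constructor <;> linarith
end

section
/- Let (H_n)_{n=0}^N be a filtration on a probability space and for 1 ≤ n ≤ N let B_n be an event in H_n. Suppose p ∈ [0,1] is such that P(B_n | H_{n−1}) ≤ p almost surely for every 1 ≤ n ≤ N. Then for every c ≥ 0: E[ exp( c · ∑_{n=1}^N 1_{B_n} ) ] ≤ (1 + p(e^c − 1))^N. -/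
open MeasureTheory ProbabilityTheory

/-- If `P(B | m) ≤ p` a.s., then `E[X 1_B] ≤ p E[X]` for every bounded nonnegative
`m`-measurable `X`. -/
lemma integral_mul_indicator_le_of_condExp_le {Ω : Type*} {m m0 : MeasurableSpace Ω}
    {P : Measure Ω} [IsFiniteMeasure P] (hm : m ≤ m0) {B : Set Ω} (hB : MeasurableSet B)
    {p : ℝ} (hp : ∀ᵐ ω ∂P, (P[B.indicator (fun _ => (1 : ℝ))|m]) ω ≤ p)
    {X : Ω → ℝ} (hX : StronglyMeasurable[m] X) (hX0 : ∀ ω, 0 ≤ X ω) {K : ℝ}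
    (hXK : ∀ ω, X ω ≤ K) :
    ∫ ω, X ω * B.indicator (fun _ => (1 : ℝ)) ω ∂P ≤ p * ∫ ω, X ω ∂P := by
  have hbound : ∀ᵐ ω ∂P, ‖X ω‖ ≤ K :=
    .of_forall fun ω => by rw [Real.norm_of_nonneg (hX0 ω)]; exact hXK ω
  have hXint : Integrable X P := .of_bound (hX.mono hm).aestronglyMeasurable K hbound
  have hBint : Integrable (B.indicator (fun _ => (1 : ℝ))) P :=
    (integrable_const 1).indicator hB
  have hpull := condExp_stronglyMeasurable_mul_of_bound hm hX hBint K hbound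
  calc ∫ ω, X ω * B.indicator (fun _ => (1 : ℝ)) ω ∂P
      = ∫ ω, (P[X * B.indicator (fun _ => (1 : ℝ))|m]) ω ∂P := (integral_condExp hm).symm
    _ ≤ ∫ ω, p * X ω ∂P := by
        refine integral_mono_ae integrable_condExp (hXint.const_mul p) ?_
        filter_upwards [hpull, hp] with ω hω hpω
        rw [hω, Pi.mul_apply, mul_comm p]
        exact mul_le_mul_of_nonneg_left hpω (hX0 ω)
    _ = p * ∫ ω, X ω ∂P := integral_const_mul p X

/-- If `(Hₙ)` is a filtration, `Bₙ ∈ Hₙ`, and `P(Bₙ | Hₙ₋₁) ≤ p` a.s. for `1 ≤ n ≤ N`,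
then `E[exp(c ∑_{n=1}^N 1_{Bₙ})] ≤ (1 + p(e^c − 1))^N` for every `c ≥ 0`. -/
theorem stmt18 {Ω : Type*} [m0 : MeasurableSpace Ω] (P : Measure Ω)
    [IsProbabilityMeasure P]
    (N : ℕ) (H : ℕ → MeasurableSpace Ω)
    (hHmono : Monotone H) (hHle : ∀ n, H n ≤ m0)
    (B : ℕ → Set Ω)
    (hB : ∀ n, 1 ≤ n → n ≤ N → MeasurableSet[H n] (B n))
    (p : ℝ) (hp0 : 0 ≤ p) (hp1 : p ≤ 1)
    (hcond : ∀ n, 1 ≤ n → n ≤ N →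
      ∀ᵐ ω ∂P, (P[(B n).indicator (fun _ => (1 : ℝ))|H (n - 1)]) ω ≤ p)
    (c : ℝ) (hc : 0 ≤ c) :
    ∫ ω, Real.exp (c * ∑ n ∈ Finset.Icc 1 N, (B n).indicator (fun _ => (1 : ℝ)) ω) ∂P
      ≤ (1 + p * (Real.exp c - 1)) ^ N := by
  induction N with
  | zero => simp
  | succ k ih =>
    have ih := ih (fun n h1 h2 => hB n h1 (h2.trans k.le_succ))
      (fun n h1 h2 => hcond n h1 (h2.trans k.le_succ))
    set X : Ω → ℝ := fun ω =>
      Real.exp (c * ∑ n ∈ Finset.Icc 1 k, (B n).indicator (fun _ => (1 : ℝ)) ω) with hXdef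
    have hXmeas : Measurable[H k] X := by
      refine Real.measurable_exp.comp (Measurable.const_mul ?_ c)
      refine Finset.measurable_fun_sum _ fun n hn => ?_
      obtain ⟨h1, h2⟩ := Finset.mem_Icc.mp hn
      exact measurable_const.indicator (hHmono h2 _ (hB n h1 (h2.trans k.le_succ)))
    have hX0 : ∀ ω, 0 ≤ X ω := fun ω => (Real.exp_pos _).le
    have hXK : ∀ ω, X ω ≤ Real.exp (c * k) := fun ω => by
      refine Real.exp_le_exp.mpr (mul_le_mul_of_nonneg_left ?_ hc)
      calc ∑ n ∈ Finset.Icc 1 k, (B n).indicator (fun _ => (1 : ℝ)) ω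
          ≤ ∑ n ∈ Finset.Icc 1 k, (1 : ℝ) :=
            Finset.sum_le_sum fun n _ => Set.indicator_le_self' (fun _ _ => zero_le_one) ω
        _ = k := by simp
    have hBk : MeasurableSet (B (k + 1)) := hHle _ _ (hB (k + 1) (by omega) le_rfl)
    have hXint : Integrable X P := by
      refine .of_bound (hXmeas.mono (hHle k) le_rfl).aestronglyMeasurable (Real.exp (c * k))
        (.of_forall fun ω => ?_)
      rw [Real.norm_of_nonneg (hX0 ω)]
      exact hXK ω
    have hXBint : Integrable (fun ω => X ω * (B (k + 1)).indicator (fun _ => (1 : ℝ)) ω) P := by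
      refine (hXint.indicator hBk).congr (.of_forall fun ω => ?_)
      by_cases hω : ω ∈ B (k + 1) <;> simp [hω]
    have hstep := integral_mul_indicator_le_of_condExp_le (hHle k) hBk
      (hcond (k + 1) (by omega) le_rfl) hXmeas.stronglyMeasurable hX0 hXK
    have hsplit : ∀ ω, Real.exp (c * ∑ n ∈ Finset.Icc 1 (k + 1),
        (B n).indicator (fun _ => (1 : ℝ)) ω)
        = X ω + (Real.exp c - 1) * (X ω * (B (k + 1)).indicator (fun _ => (1 : ℝ)) ω) := by
      intro ω
      rw [Finset.sum_Icc_succ_top (by omega), mul_add, Real.exp_add]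
      by_cases hω : ω ∈ B (k + 1)
      · simp only [hXdef, Set.indicator_of_mem hω]
        ring_nf
      · simp [hXdef, hω]
    have hc1 : 0 ≤ Real.exp c - 1 := sub_nonneg.mpr (Real.one_le_exp hc)
    simp_rw [hsplit]
    rw [integral_add hXint (hXBint.const_mul _), integral_const_mul]
    calc _ ≤ ∫ ω, X ω ∂P + (Real.exp c - 1) * (p * ∫ ω, X ω ∂P) := by gcongr
      _ = (∫ ω, X ω ∂P) * (1 + p * (Real.exp c - 1)) := by ring
      _ ≤ (1 + p * (Real.exp c - 1)) ^ k * (1 + p * (Real.exp c - 1)) := by gcongr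
      _ = (1 + p * (Real.exp c - 1)) ^ (k + 1) := (pow_succ _ _).symm
end

section
/- For all T ≥ 0 and a > 0 the following pathwise implications hold: (i) if A(t) − αt > a for some t ∈ [0,T], then max_{0≤n≤⌈αT+a⌉} (n/α − C(n)) ≥ a/α; (ii) if A(t) − αt < −a for some t ∈ [0,T], then there exists an integer n with 1 ≤ n ≤ ⌊αT−a⌋+1 such that C(n) − n/α > (a−1)/α. -/
/-- Partial sums `C(n) = ∑_{l=1}^n u(l)` (with `u l` the `(l+1)`-st term, `l = 0,1,…`). -/
noncomputable def partialSum (u : ℕ → ℝ) (n : ℕ) : ℝ :=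
  ∑ l ∈ Finset.range n, u l

/-- The counting function `A(t) = max{n ≥ 0 : C(n) ≤ t}`. -/
noncomputable def countFn (u : ℕ → ℝ) (t : ℝ) : ℕ :=
  sSup {n : ℕ | partialSum u n ≤ t}

theorem partialSum_mono {u : ℕ → ℝ} (hu : ∀ l, 0 < u l) : Monotone (partialSum u) :=
  (Finset.sum_mono_set_of_nonneg fun l => (hu l).le).comp Finset.range_mono

theorem bddAbove_setOf_partialSum_le {u : ℕ → ℝ}
    (htop : Filter.Tendsto (partialSum u) Filter.atTop Filter.atTop) (t : ℝ) :
    BddAbove {n : ℕ | partialSum u n ≤ t} := by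
  obtain ⟨N, hN⟩ := Filter.eventually_atTop.1 (htop.eventually_gt_atTop t)
  refine ⟨N, fun n hn => ?_⟩
  by_contra! h
  exact absurd (hN n h.le) (not_lt.2 hn)

theorem le_countFn_iff {u : ℕ → ℝ} (hu : ∀ l, 0 < u l)
    (htop : Filter.Tendsto (partialSum u) Filter.atTop Filter.atTop) {t : ℝ} (ht : 0 ≤ t)
    (n : ℕ) : n ≤ countFn u t ↔ partialSum u n ≤ t := by
  have hbdd := bddAbove_setOf_partialSum_le htop t
  refine ⟨fun h => (partialSum_mono hu h).trans ?_, fun h => le_csSup hbdd h⟩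
  exact Nat.sSup_mem (s := {n : ℕ | partialSum u n ≤ t}) ⟨0, by simpa [partialSum] using ht⟩ hbdd

/-- Pathwise comparison between deviations of the counting function and deviations of
the partial sums:
(i) if `A(t) − αt > a` for some `t ∈ [0,T]`, then `max_{0≤n≤⌈αT+a⌉}(n/α − C(n)) ≥ a/α`;
(ii) if `A(t) − αt < −a` for some `t ∈ [0,T]`, then `C(n) − n/α > (a−1)/α` for some
`1 ≤ n ≤ ⌊αT−a⌋+1`. -/
theorem stmt19 (u : ℕ → ℝ) (hu : ∀ l, 0 < u l)
    (htop : Filter.Tendsto (partialSum u) Filter.atTop Filter.atTop)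
    (α : ℝ) (hα : 0 < α) (T a : ℝ) (hT : 0 ≤ T) (ha : 0 < a) :
    ((∃ t ∈ Set.Icc (0 : ℝ) T, a < (countFn u t : ℝ) - α * t) →
      ∃ n : ℕ, n ≤ ⌈α * T + a⌉₊ ∧ a / α ≤ (n : ℝ) / α - partialSum u n) ∧
    ((∃ t ∈ Set.Icc (0 : ℝ) T, (countFn u t : ℝ) - α * t < -a) →
      ∃ n : ℕ, 1 ≤ n ∧ n ≤ ⌊α * T - a⌋₊ + 1 ∧
        (a - 1) / α < partialSum u n - (n : ℝ) / α) := by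
  constructor
  · rintro ⟨t, ⟨ht0, htT⟩, h⟩
    refine ⟨⌈α * t + a⌉₊, by gcongr, ?_⟩
    have hC : partialSum u ⌈α * t + a⌉₊ ≤ t :=
      (le_countFn_iff hu htop ht0 _).1 (Nat.ceil_le.2 (by linarith))
    have hn : (α * t + a) / α ≤ (⌈α * t + a⌉₊ : ℝ) / α := by
      gcongr
      exact Nat.le_ceil _
    rw [add_div, mul_div_cancel_left₀ _ hα.ne'] at hn
    linarith
  · rintro ⟨t, ⟨ht0, htT⟩, h⟩
    refine ⟨⌊α * t - a⌋₊ + 1, Nat.le_add_left _ _, by gcongr, ?_⟩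
    have hpos : 0 ≤ α * t - a := by
      have := Nat.cast_nonneg (α := ℝ) (countFn u t)
      linarith
    have hC : t < partialSum u (⌊α * t - a⌋₊ + 1) := by
      rw [← not_le, ← le_countFn_iff hu htop ht0, not_le, Nat.lt_succ_iff]
      exact Nat.le_floor (by linarith)
    have hn : ((⌊α * t - a⌋₊ + 1 : ℕ) : ℝ) / α ≤ (α * t - (a - 1)) / α := by
      gcongr
      push_cast
      linarith [Nat.floor_le hpos]
    rw [sub_div, mul_div_cancel_left₀ _ hα.ne'] at hn
    linarith
end
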